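/- Let A be a C*-algebra, M an A-reflexive Hilbert A-module, and N ⊆ M a Hilbert A-submodule. Then the biorthogonal complement N^⊥⊥ of N computed in M is itself an A-reflexive Hilbert A-module, i.e., the canonical map Ω : N^⊥⊥ → (N^⊥⊥)'' is an isometric isomorphism. -/

import Mathlib

noncomputable section

open scoped ENNReal MultiplierAlgebra

universe u v w

/-- A (left) Hilbert C*-module over a (not necessarily unital) C*-algebra `A`:
a Banach space `M` which is a (nonunital) left `A`-module equipped with an `A`-valued
inner product, `A`-linear in the first variable, satisfying `⟨x,y⟩ = ⟨y,x⟩*`,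
`⟨x,x⟩ ≥ 0` (i.e. of the form `b* b`), definiteness, and such that the norm of `M`
satisfies `‖x‖ = ‖⟨x,x⟩‖ ^ (1/2)` and `M` is complete. -/
class HilbertCStarModule (A : Type u) (M : Type v) [NonUnitalCStarAlgebra A]
    [NormedAddCommGroup M] [NormedSpace ℂ M] [SMul A M] where
  inner : M → M → A
  smul_add' : ∀ (a : A) (x y : M), a • (x + y) = a • x + a • y
  add_smul' : ∀ (a b : A) (x : M), (a + b) • x = a • x + b • x
  mul_smul' : ∀ (a b : A) (x : M), (a * b) • x = a • (b • x)
  smul_smul' : ∀ (c : ℂ) (a : A) (x : M), (c • a) • x = c • (a • x)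
  inner_add_left : ∀ x y z : M, inner (x + y) z = inner x z + inner y z
  inner_smulA_left : ∀ (a : A) (x y : M), inner (a • x) y = a * inner x y
  inner_smulC_left : ∀ (c : ℂ) (x y : M), inner (c • x) y = c • inner x y
  inner_conj : ∀ x y : M, inner x y = star (inner y x)
  inner_self_pos : ∀ x : M, ∃ b : A, inner x x = star b * b
  inner_self_eq_zero : ∀ x : M, inner x x = 0 ↔ x = 0
  norm_eq : ∀ x : M, ‖x‖ = Real.sqrt ‖inner x x‖
  complete : CompleteSpace M

section Defs

variable (A : Type u) [NonUnitalCStarAlgebra A] {M : Type v}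
  [NormedAddCommGroup M] [NormedSpace ℂ M] [SMul A M]

/-- The `A`-valued inner product of a Hilbert C*-module. -/
def hInner [HilbertCStarModule A M] (x y : M) : A := HilbertCStarModule.inner x y

/-- The orthogonal complement `S^⊥ = {x | ⟨x, s⟩ = 0 for all s ∈ S}` of a subset `S`. -/
def orthComp [HilbertCStarModule A M] (S : Set M) : Set M :=
  {x : M | ∀ s ∈ S, hInner A x s = 0}

/-- A Hilbert C*-submodule: a norm-closed subset which is closed under addition and under
the actions of `ℂ` and `A`. -/
structure IsHilbertSubmodule (N : Set M) : Prop where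
  isClosed : IsClosed N
  zero_mem : (0 : M) ∈ N
  add_mem : ∀ ⦃x y : M⦄, x ∈ N → y ∈ N → x + y ∈ N
  smulC_mem : ∀ (c : ℂ) ⦃x : M⦄, x ∈ N → c • x ∈ N
  smulA_mem : ∀ (a : A) ⦃x : M⦄, x ∈ N → a • x ∈ N

end Defs

section Maps

variable (A : Type u) [NonUnitalCStarAlgebra A] {M : Type v} {M₂ : Type w}
  [NormedAddCommGroup M] [NormedSpace ℂ M] [SMul A M]
  [NormedAddCommGroup M₂] [NormedSpace ℂ M₂] [SMul A M₂]

/-- A bounded `A`-linear map between (left) normed `A`-modules. -/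
structure IsBoundedModuleMap (T : M → M₂) : Prop where
  map_add : ∀ x y : M, T (x + y) = T x + T y
  map_smulC : ∀ (c : ℂ) (x : M), T (c • x) = c • T x
  map_smulA : ∀ (a : A) (x : M), T (a • x) = a • T x
  bound : ∃ C : ℝ, ∀ x : M, ‖T x‖ ≤ C * ‖x‖

/-- The operator norm of a map between normed modules. -/
def opNorm (T : M → M₂) : ℝ :=
  sInf {c : ℝ | 0 ≤ c ∧ ∀ x : M, ‖T x‖ ≤ c * ‖x‖}

end Maps

section Dual

variable (A : Type u) [NonUnitalCStarAlgebra A] {M : Type v}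
  [NormedAddCommGroup M] [NormedSpace ℂ M] [SMul A M]

/-- A bounded `A`-linear map `M → A`, i.e. an element of the `A`-dual `M'`. -/
structure IsDualVector (r : M → A) : Prop where
  map_add : ∀ x y : M, r (x + y) = r x + r y
  map_smulC : ∀ (c : ℂ) (x : M), r (c • x) = c • r x
  map_smulA : ∀ (a : A) (x : M), r (a • x) = a * r x
  bound : ∃ C : ℝ, ∀ x : M, ‖r x‖ ≤ C * ‖x‖

/-- The norm of an element of the `A`-dual. -/
def dualNorm (r : M → A) : ℝ :=
  sInf {c : ℝ | 0 ≤ c ∧ ∀ x : M, ‖r x‖ ≤ c * ‖x‖}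

/-- A function `r : M → A` which restricts to a bounded `A`-linear map on the subset `S`;
this represents an element of the `A`-dual `S'` of the submodule `S` (only the values on `S`
are relevant). -/
structure IsDualVectorOn (S : Set M) (r : M → A) : Prop where
  map_add : ∀ x ∈ S, ∀ y ∈ S, r (x + y) = r x + r y
  map_smulC : ∀ (c : ℂ), ∀ x ∈ S, r (c • x) = c • r x
  map_smulA : ∀ (a : A), ∀ x ∈ S, r (a • x) = a * r x
  bound : ∃ C : ℝ, ∀ x ∈ S, ‖r x‖ ≤ C * ‖x‖

/-- The norm of a bounded `A`-linear map given on the subset `S`. -/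
def dualNormOn (S : Set M) (r : M → A) : ℝ :=
  sInf {c : ℝ | 0 ≤ c ∧ ∀ x ∈ S, ‖r x‖ ≤ c * ‖x‖}

/-- The canonical embedding of `M` into its `A`-dual: `x ↦ ⟨·, x⟩`. -/
def toDualFun [HilbertCStarModule A M] (x : M) : M → A := fun y => hInner A y x

/-- The canonical evaluation map of `M` into its `A`-bidual: `Ω x : r ↦ r x`. -/
def omegaFun (x : M) : (M → A) → A := fun r => r x

/-- A bounded `A`-linear functional on the `A`-dual `M'`, i.e. an element of the
`A`-bidual `M''`.  Here `M'` carries the `A`-action `(a • r) x = r x * (star a)`, and the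
corresponding `A`-linearity for functionals on `M'` reads `F (a • r) = F r * star a`
(which holds for all evaluation functionals `Ω x`). -/
structure IsBidualVector (F : (M → A) → A) : Prop where
  map_add : ∀ r s : M → A, IsDualVector A r → IsDualVector A s →
    F (fun x => r x + s x) = F r + F s
  map_smulC : ∀ (c : ℂ) (r : M → A), IsDualVector A r →
    F (fun x => c • r x) = c • F r
  map_smulA : ∀ (a : A) (r : M → A), IsDualVector A r →
    F (fun x => r x * star a) = F r * star a
  bound : ∃ C : ℝ, ∀ r : M → A, IsDualVector A r → ‖F r‖ ≤ C * dualNorm A r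

/-- The norm of an element of the `A`-bidual. -/
def bidualNorm (F : (M → A) → A) : ℝ :=
  sInf {c : ℝ | 0 ≤ c ∧ ∀ r : M → A, IsDualVector A r → ‖F r‖ ≤ c * dualNorm A r}

/-- An element of the `A`-bidual `S''` of a submodule `S ⊆ M`, represented as a functional
on (representatives of) elements of the `A`-dual `S'`. -/
structure IsBidualVectorOn (S : Set M) (F : (M → A) → A) : Prop where
  congr : ∀ r s : M → A, IsDualVectorOn A S r → IsDualVectorOn A S s →
    (∀ x ∈ S, r x = s x) → F r = F s
  map_add : ∀ r s : M → A, IsDualVectorOn A S r → IsDualVectorOn A S s →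
    F (fun x => r x + s x) = F r + F s
  map_smulC : ∀ (c : ℂ) (r : M → A), IsDualVectorOn A S r →
    F (fun x => c • r x) = c • F r
  map_smulA : ∀ (a : A) (r : M → A), IsDualVectorOn A S r →
    F (fun x => r x * star a) = F r * star a
  bound : ∃ C : ℝ, ∀ r : M → A, IsDualVectorOn A S r → ‖F r‖ ≤ C * dualNormOn A S r

/-- The norm of an element of the `A`-bidual of a submodule `S`. -/
def bidualNormOn (S : Set M) (F : (M → A) → A) : ℝ :=
  sInf {c : ℝ | 0 ≤ c ∧ ∀ r : M → A, IsDualVectorOn A S r → ‖F r‖ ≤ c * dualNormOn A S r}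

/-- `M` is `A`-reflexive if the canonical map `Ω : M → M''` is surjective. -/
def IsCReflexive [HilbertCStarModule A M] : Prop :=
  ∀ F : (M → A) → A, IsBidualVector A F →
    ∃ x : M, ∀ r : M → A, IsDualVector A r → F r = r x

end Dual

section Order

/-- The C*-order relation: `x ≤ y` iff `y - x` is positive, i.e. of the form `c* c`. -/
def cstarLE {B : Type*} [NonUnitalRing B] [Star B] (x y : B) : Prop :=
  ∃ c : B, y - x = star c * c

/-- `m` is the least upper bound of `S` with respect to the C*-order. -/
def IsCStarLUB {B : Type*} [NonUnitalRing B] [Star B] (S : Set B) (m : B) : Prop :=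
  (∀ b ∈ S, cstarLE b m) ∧ ∀ u : B, (∀ b ∈ S, cstarLE b u) → cstarLE m u

/-- A C*-algebra is monotone complete if every norm-bounded increasingly directed set of
self-adjoint elements has a least upper bound. -/
def MonotoneComplete (B : Type*) [NonUnitalNormedRing B] [StarRing B] : Prop :=
  ∀ S : Set B, S.Nonempty → (∀ b ∈ S, star b = b) →
    (∀ x ∈ S, ∀ y ∈ S, ∃ z ∈ S, cstarLE x z ∧ cstarLE y z) →
    (∃ C : ℝ, ∀ b ∈ S, ‖b‖ ≤ C) →
    ∃ m : B, IsCStarLUB S m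

/-- A C*-algebra is additively complete if every family of positive elements whose finite
partial sums are norm-bounded has a least upper bound (of the set of its finite partial
sums). -/
def AdditivelyComplete (B : Type w) [NonUnitalNormedRing B] [StarRing B] : Prop :=
  ∀ (ι : Type w) (f : ι → B), (∀ i, ∃ c : B, f i = star c * c) →
    (∃ C : ℝ, ∀ s : Finset ι, ‖∑ i ∈ s, f i‖ ≤ C) →
    ∃ m : B, IsCStarLUB {b : B | ∃ s : Finset ι, b = ∑ i ∈ s, f i} m

end Order

/-- The Hahn-Banach type extension property of a C*-algebra `A`: for every Hilbert
`A`-module `M` and every Hilbert `A`-submodule `N ⊆ M`, every bounded `A`-linear map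
`r : N → A` extends to a bounded `A`-linear map `r' : M → A` with the same norm, with
`r'` restricted to `N` equal to `r` and `r'` vanishing on `N^⊥`. -/
def ExtensionProperty (A : Type u) [NonUnitalCStarAlgebra A] : Prop :=
  ∀ (M : Type v) [NormedAddCommGroup M] [NormedSpace ℂ M] [SMul A M]
    [HilbertCStarModule A M] (N : Set M), IsHilbertSubmodule A N →
    ∀ r : M → A, IsDualVectorOn A N r →
      ∃ r' : M → A, IsDualVector A r' ∧ dualNorm A r' = dualNormOn A N r ∧
        (∀ x ∈ N, r' x = r x) ∧ (∀ x ∈ orthComp A N, r' x = 0)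

section CStarAlgebraEstimates

variable {A : Type u} [NonUnitalCStarAlgebra A]

attribute [local instance] CStarAlgebra.spectralOrder CStarAlgebra.spectralOrderedRing

/-- A positive element whose norm is within `ε` of `m` admits a nonzero self-adjoint `d` on which
it acts like the scalar `m`, up to `ε`. -/
lemma exists_isSelfAdjoint_norm_smul_sub_conj_le {k : A} (hk : 0 ≤ k) {m ε : ℝ}
    (hεm : ε ≤ m) (hkm : ‖k‖ ≤ m) (hmk : m - ε < ‖k‖) :
    ∃ d : A, IsSelfAdjoint d ∧ d ≠ 0 ∧ ‖m • (d * d) - d * k * d‖ ≤ ε * ‖d‖ ^ 2 := by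
  have hksa : IsSelfAdjoint k := .of_nonneg hk
  set f : ℝ → ℝ := fun t => max 0 (t - (m - ε)) with hf
  have hfc : Continuous f := by fun_prop
  have hf0 : f 0 = 0 := by simp [hf, hεm]
  have hσ : ∀ x ∈ quasispectrum ℝ k, 0 ≤ x := fun x hx =>
    quasispectrum_nonneg_of_nonneg k hk x hx
  have hσm : ∀ x ∈ quasispectrum ℝ k, x ≤ m := fun x hx =>
    (le_abs_self x).trans <|
      (NonUnitalIsometricContinuousFunctionalCalculus.norm_quasispectrum_le (𝕜 := ℝ) k hx hksa).trans hkm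
  have hfd : ∀ x ∈ quasispectrum ℝ k, f x ≤ ‖cfcₙ f k‖ := fun x hx =>
    (le_abs_self _).trans (norm_apply_le_norm_cfcₙ f k hx hfc.continuousOn hf0 hksa)
  obtain ⟨t, ht, htk⟩ := (IsGreatest.norm_cfcₙ (𝕜 := ℝ) id k).1
  rw [cfcₙ_id ℝ k] at htk
  have htk' : t = ‖k‖ := by rw [← htk]; simp [abs_of_nonneg (hσ t ht)]
  refine ⟨cfcₙ f k, cfcₙ_predicate f k, fun h0 => ?_, ?_⟩
  · have h := hfd t ht
    rw [h0, norm_zero, htk'] at h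
    have : ‖k‖ - (m - ε) ≤ f ‖k‖ := le_max_right _ _
    linarith
  · have hkey : m • (cfcₙ f k * cfcₙ f k) - cfcₙ f k * k * cfcₙ f k
        = cfcₙ (fun t => m * (f t * f t) - f t * t * f t) k := by
      rw [cfcₙ_sub (fun t => m * (f t * f t)) (fun t => f t * t * f t) k,
        cfcₙ_const_mul m (fun t => f t * f t) k, cfcₙ_mul f f k,
        cfcₙ_mul (fun t => f t * t) f k, cfcₙ_mul f (fun t => t) k, cfcₙ_id' ℝ k]
    rw [hkey]
    refine norm_cfcₙ_le fun x hx => ?_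
    have hfx0 : 0 ≤ f x := le_max_left _ _
    have hxm := hσm x hx
    have hsq : f x ^ 2 ≤ ‖cfcₙ f k‖ ^ 2 := pow_le_pow_left₀ hfx0 (hfd x hx) 2
    have hε : 0 ≤ ε := by linarith
    have hrw : m * (f x * f x) - f x * x * f x = (m - x) * f x ^ 2 := by ring
    rw [hrw, Real.norm_eq_abs, abs_of_nonneg (mul_nonneg (by linarith) (sq_nonneg _))]
    rcases le_or_gt x (m - ε) with h | h
    · have : f x = 0 := max_eq_left (by linarith)
      rw [this]
      simp only [ne_eq, OfNat.ofNat_ne_zero, not_false_eq_true, zero_pow, mul_zero]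
      positivity
    · exact (mul_le_mul_of_nonneg_right (by linarith) (sq_nonneg _)).trans
        (mul_le_mul_of_nonneg_left hsq hε)

lemma star_conj_le_of_norm_le_one {e : A} (he : 0 ≤ e) (h1 : ‖e‖ ≤ 1) (u : A) :
    u * e * star u ≤ u * star u := by
  refine (CStarAlgebra.star_right_conjugate_le_norm_smul (.of_nonneg he)).trans ?_
  simpa using smul_le_smul_of_nonneg_right h1 (mul_star_self_nonneg u)

end CStarAlgebraEstimates

section InnerProduct

variable {A : Type u} [NonUnitalCStarAlgebra A] {M : Type v}
  [NormedAddCommGroup M] [NormedSpace ℂ M] [SMul A M] [HilbertCStarModule A M]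

attribute [local instance] CStarAlgebra.spectralOrder CStarAlgebra.spectralOrderedRing

lemma hInner_add_left (x y z : M) : hInner A (x + y) z = hInner A x z + hInner A y z :=
  HilbertCStarModule.inner_add_left x y z

lemma hInner_smulC_left (c : ℂ) (x y : M) : hInner A (c • x) y = c • hInner A x y :=
  HilbertCStarModule.inner_smulC_left c x y

lemma hInner_smulA_left (a : A) (x y : M) : hInner A (a • x) y = a * hInner A x y :=
  HilbertCStarModule.inner_smulA_left a x y

lemma star_hInner (x y : M) : star (hInner A x y) = hInner A y x :=
  (HilbertCStarModule.inner_conj y x).symm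

lemma hInner_sub_left (x y z : M) : hInner A (x - y) z = hInner A x z - hInner A y z := by
  have h : x - y = x + (-1 : ℂ) • y := by rw [neg_one_smul, sub_eq_add_neg]
  rw [h, hInner_add_left, hInner_smulC_left, neg_one_smul, sub_eq_add_neg]

lemma hInner_add_right (x y z : M) : hInner A x (y + z) = hInner A x y + hInner A x z := by
  rw [← star_hInner, hInner_add_left, star_add, star_hInner, star_hInner]

lemma hInner_sub_right (x y z : M) : hInner A x (y - z) = hInner A x y - hInner A x z := by
  rw [← star_hInner, hInner_sub_left, star_sub, star_hInner, star_hInner]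

lemma hInner_smulA_right (a : A) (x y : M) : hInner A x (a • y) = hInner A x y * star a := by
  rw [← star_hInner, hInner_smulA_left, star_mul, star_hInner]

lemma hInner_smulC_right (c : ℂ) (x y : M) : hInner A x (c • y) = star c • hInner A x y := by
  rw [← star_hInner, hInner_smulC_left, star_smul, star_hInner]

lemma hInner_self_nonneg (x : M) : 0 ≤ hInner A x x := by
  obtain ⟨b, hb⟩ := HilbertCStarModule.inner_self_pos (A := A) x
  rw [hInner, hb]
  exact star_mul_self_nonneg b

variable (A) in
lemma norm_hInner_self (x : M) : ‖hInner A x x‖ = ‖x‖ ^ 2 := by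
  rw [HilbertCStarModule.norm_eq (A := A) x, Real.sq_sqrt (norm_nonneg _)]
  rfl

/-- Cauchy–Schwarz inequality. -/
lemma norm_hInner_le (x y : M) : ‖hInner A x y‖ ≤ ‖x‖ * ‖y‖ := by
  rcases eq_or_ne y 0 with rfl | hy
  · have h : hInner A x 0 = 0 := by simpa using hInner_sub_right (A := A) x 0 0
    simp [h]
  have hy0 : 0 < ‖y‖ := norm_pos_iff.2 hy
  set a := hInner A x y with ha
  have hya : hInner A y x = star a := (star_hInner x y).symm
  set t : ℝ := ‖y‖ ^ 2 with ht
  have ht0 : 0 < t := by positivity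
  have h1 : a * hInner A y y * star a ≤ t • (a * star a) := by
    have := CStarAlgebra.star_right_conjugate_le_norm_smul (a := a)
      (.of_nonneg (hInner_self_nonneg (A := A) y))
    rwa [norm_hInner_self] at this
  have h2 := hInner_self_nonneg (A := A) ((t : ℂ) • x - a • y)
  have h3 : hInner A ((t : ℂ) • x - a • y) ((t : ℂ) • x - a • y)
      = t • (t • hInner A x x) - t • (a * star a) - t • (a * star a)
        + a * hInner A y y * star a := by
    simp only [hInner_sub_left, hInner_sub_right, hInner_smulA_left, hInner_smulA_right,
      hInner_smulC_left, hInner_smulC_right, ← ha, hya, Complex.star_def, Complex.conj_ofReal]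
    simp only [Complex.coe_smul, smul_mul_assoc, smul_sub, sub_mul, mul_assoc]
    abel
  have h4 : t • (a * star a) ≤ t • (t • hInner A x x) := by
    rw [h3] at h2
    have h5 := h2.trans (add_le_add_right h1 _)
    rw [sub_add_cancel] at h5
    exact sub_nonneg.1 h5
  have h6 := CStarAlgebra.norm_le_norm_of_nonneg_of_le
    (smul_nonneg ht0.le (mul_star_self_nonneg a)) h4
  rw [norm_smul, norm_smul, norm_smul, CStarRing.norm_self_mul_star, norm_hInner_self,
    Real.norm_of_nonneg ht0.le] at h6
  have h7 := le_of_mul_le_mul_left h6 ht0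
  refine abs_le_of_sq_le_sq' ?_ (by positivity) |>.2
  rw [mul_pow, ← ht]
  linarith

/-- For `‖x‖, ‖z‖ ≤ 1`, the row operator with entries `x` and `z - ⟨z, x⟩ x` is a contraction. -/
lemma norm_smul_add_smul_sub_sq_le {x z : M} (hx : ‖x‖ ≤ 1) (hz : ‖z‖ ≤ 1) (u v : A) :
    ‖u • x + v • (z - hInner A z x • x)‖ ^ 2 ≤ ‖u * star u + v * star v‖ := by
  have hle : ∀ y : M, ‖y‖ ≤ 1 → ‖hInner A y y‖ ≤ 1 := fun y hy => by
    rw [norm_hInner_self]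
    exact pow_le_one₀ (norm_nonneg _) hy
  rw [← norm_hInner_self A]
  refine CStarAlgebra.norm_le_norm_of_nonneg_of_le (hInner_self_nonneg _) ?_
  set p := hInner A z x with hp
  have hxz : hInner A x z = star p := (star_hInner z x).symm
  have he : star (hInner A x x) = hInner A x x := star_hInner x x
  have h1 := star_conj_le_of_norm_le_one (hInner_self_nonneg (A := A) z) (hle z hz) v
  have h2 := star_conj_le_of_norm_le_one (hInner_self_nonneg (A := A) x) (hle x hx) (u - v * p)
  have h3 := mul_star_self_nonneg (v * p)
  rw [← sub_nonneg] at h1 h2 ⊢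
  refine (add_nonneg (add_nonneg h1 h2) h3).trans_eq ?_
  simp only [hInner_add_left, hInner_add_right, hInner_sub_left, hInner_sub_right,
    hInner_smulA_left, hInner_smulA_right, ← hp, hxz, star_mul, star_sub]
  noncomm_ring

end InnerProduct

section Submodule

variable {A : Type u} [NonUnitalCStarAlgebra A] {M : Type v}
  [NormedAddCommGroup M] [NormedSpace ℂ M] [SMul A M] [HilbertCStarModule A M] {T : Set M}

lemma orthComp_add_mem {x y : M} (hx : x ∈ orthComp A T) (hy : y ∈ orthComp A T) :
    x + y ∈ orthComp A T := fun s hs => by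
  rw [hInner_add_left, hx s hs, hy s hs, add_zero]

lemma orthComp_sub_mem {x y : M} (hx : x ∈ orthComp A T) (hy : y ∈ orthComp A T) :
    x - y ∈ orthComp A T := fun s hs => by
  rw [hInner_sub_left, hx s hs, hy s hs, sub_zero]

lemma orthComp_smulC_mem (c : ℂ) {x : M} (hx : x ∈ orthComp A T) :
    c • x ∈ orthComp A T := fun s hs => by
  rw [hInner_smulC_left, hx s hs, smul_zero]

lemma orthComp_smulA_mem (a : A) {x : M} (hx : x ∈ orthComp A T) :
    a • x ∈ orthComp A T := fun s hs => by
  rw [hInner_smulA_left, hx s hs, mul_zero]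

end Submodule

section DualNorm

variable {A : Type u} [NonUnitalCStarAlgebra A] {M : Type v} [NormedAddCommGroup M]

lemma dualNormOn_nonneg (S : Set M) (r : M → A) : 0 ≤ dualNormOn A S r :=
  Real.sInf_nonneg fun _ h => h.1

lemma dualNormOn_le {S : Set M} {r : M → A} {c : ℝ} (hc : 0 ≤ c) (h : ∀ x ∈ S, ‖r x‖ ≤ c * ‖x‖) :
    dualNormOn A S r ≤ c :=
  csInf_le ⟨0, fun _ h => h.1⟩ ⟨hc, h⟩

end DualNorm

section DualVectors

variable {A : Type u} [NonUnitalCStarAlgebra A] {M : Type v}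
  [NormedAddCommGroup M] [NormedSpace ℂ M] [SMul A M] {S : Set M} {r s : M → A}

lemma IsDualVectorOn.map_sub (hr : IsDualVectorOn A S r) {x y : M} (hx : x ∈ S) (hy : y ∈ S)
    (hy' : (-1 : ℂ) • y ∈ S) : r (x - y) = r x - r y := by
  have h : x - y = x + (-1 : ℂ) • y := by rw [neg_one_smul, sub_eq_add_neg]
  rw [h, hr.map_add x hx _ hy', hr.map_smulC _ y hy, neg_one_smul, sub_eq_add_neg]

lemma IsDualVectorOn.exists_bound (hr : IsDualVectorOn A S r) :
    ∃ C : ℝ, 0 ≤ C ∧ ∀ x ∈ S, ‖r x‖ ≤ C * ‖x‖ := by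
  obtain ⟨C, hC⟩ := hr.bound
  exact ⟨|C|, abs_nonneg C, fun x hx =>
    (hC x hx).trans (mul_le_mul_of_nonneg_right (le_abs_self C) (norm_nonneg x))⟩

lemma IsDualVectorOn.le_dualNormOn (hr : IsDualVectorOn A S r) {x : M} (hx : x ∈ S) :
    ‖r x‖ ≤ dualNormOn A S r * ‖x‖ := by
  have hne : {c : ℝ | 0 ≤ c ∧ ∀ x ∈ S, ‖r x‖ ≤ c * ‖x‖}.Nonempty := hr.exists_bound
  rcases (norm_nonneg x).eq_or_lt with h0 | h0
  · obtain ⟨C, -, hC⟩ := hne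
    simpa [← h0] using hC x hx
  · rw [← div_le_iff₀ h0]
    exact le_csInf hne fun c hc => (div_le_iff₀ h0).2 (hc.2 x hx)

lemma IsDualVectorOn.mul_right (hr : IsDualVectorOn A S r) (a : A) :
    IsDualVectorOn A S fun x => r x * a where
  map_add x hx y hy := by rw [hr.map_add x hx y hy, add_mul]
  map_smulC c x hx := by rw [hr.map_smulC c x hx, smul_mul_assoc]
  map_smulA b x hx := by rw [hr.map_smulA b x hx, mul_assoc]
  bound := by
    obtain ⟨C, hC⟩ := hr.bound
    refine ⟨C * ‖a‖, fun x hx => (norm_mul_le _ _).trans ?_⟩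
    rw [mul_right_comm]
    exact mul_le_mul_of_nonneg_right (hC x hx) (norm_nonneg a)

lemma IsDualVectorOn.sub (hr : IsDualVectorOn A S r) (hs : IsDualVectorOn A S s) :
    IsDualVectorOn A S fun x => r x - s x where
  map_add x hx y hy := by rw [hr.map_add x hx y hy, hs.map_add x hx y hy]; abel
  map_smulC c x hx := by rw [hr.map_smulC c x hx, hs.map_smulC c x hx, smul_sub]
  map_smulA b x hx := by rw [hr.map_smulA b x hx, hs.map_smulA b x hx, mul_sub]
  bound := by
    obtain ⟨C, hC⟩ := hr.bound
    obtain ⟨D, hD⟩ := hs.bound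
    refine ⟨C + D, fun x hx => (norm_sub_le _ _).trans ?_⟩
    rw [add_mul]
    exact add_le_add (hC x hx) (hD x hx)

lemma IsDualVectorOn.smul (hr : IsDualVectorOn A S r) (c : ℂ) :
    IsDualVectorOn A S fun x => c • r x where
  map_add x hx y hy := by rw [hr.map_add x hx y hy, smul_add]
  map_smulC b x hx := by rw [hr.map_smulC b x hx, smul_comm]
  map_smulA b x hx := by rw [hr.map_smulA b x hx, mul_smul_comm]
  bound := by
    obtain ⟨C, hC⟩ := hr.bound
    refine ⟨‖c‖ * C, fun x hx => ?_⟩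
    rw [norm_smul, mul_assoc]
    exact mul_le_mul_of_nonneg_left (hC x hx) (norm_nonneg c)

lemma IsDualVector.isDualVectorOn (hr : IsDualVector A r) (S : Set M) :
    IsDualVectorOn A S r where
  map_add x _ y _ := hr.map_add x y
  map_smulC c x _ := hr.map_smulC c x
  map_smulA a x _ := hr.map_smulA a x
  bound := hr.bound.imp fun _ h x _ => h x

lemma IsDualVector.dualNormOn_le_dualNorm (hr : IsDualVector A r) (S : Set M) :
    dualNormOn A S r ≤ dualNorm A r := by
  obtain ⟨C, hC⟩ := hr.bound
  refine csInf_le_csInf ⟨0, fun _ h => h.1⟩ ⟨|C|, abs_nonneg C, fun x => ?_⟩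
    fun c hc => ⟨hc.1, fun x _ => hc.2 x⟩
  exact (hC x).trans (mul_le_mul_of_nonneg_right (le_abs_self C) (norm_nonneg x))

lemma isDualVector_toDualFun [HilbertCStarModule A M] (y : M) :
    IsDualVector A (toDualFun A y) where
  map_add x x' := hInner_add_left x x' y
  map_smulC c x := hInner_smulC_left c x y
  map_smulA a x := hInner_smulA_left a x y
  bound := ⟨‖y‖, fun x => (norm_hInner_le x y).trans_eq (mul_comm _ _)⟩

end DualVectors

section BidualVectors

variable {A : Type u} [NonUnitalCStarAlgebra A] {M : Type v}
  [NormedAddCommGroup M] [NormedSpace ℂ M] [SMul A M] {S : Set M} {r s : M → A}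
  {F G : (M → A) → A}

lemma IsBidualVectorOn.map_sub (hF : IsBidualVectorOn A S F) (hr : IsDualVectorOn A S r)
    (hs : IsDualVectorOn A S s) : F (fun x => r x - s x) = F r - F s := by
  have h := hF.map_add r _ hr (hs.smul (-1))
  rw [hF.map_smulC _ s hs] at h
  simpa only [neg_one_smul, ← sub_eq_add_neg] using h

lemma IsBidualVectorOn.map_mul_right (hF : IsBidualVectorOn A S F) (hr : IsDualVectorOn A S r)
    (a : A) : F (fun x => r x * a) = F r * a := by
  simpa only [star_star] using hF.map_smulA (star a) r hr

lemma IsBidualVectorOn.exists_bound (hF : IsBidualVectorOn A S F) :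
    ∃ C : ℝ, 0 ≤ C ∧ ∀ r, IsDualVectorOn A S r → ‖F r‖ ≤ C * dualNormOn A S r := by
  obtain ⟨C, hC⟩ := hF.bound
  exact ⟨|C|, abs_nonneg C, fun r hr =>
    (hC r hr).trans (mul_le_mul_of_nonneg_right (le_abs_self C) (dualNormOn_nonneg S r))⟩

lemma IsBidualVectorOn.map_eq_zero (hF : IsBidualVectorOn A S F) (hr : IsDualVectorOn A S r)
    (h : ∀ x ∈ S, r x = 0) : F r = 0 := by
  have h0 := hF.congr r _ hr (hr.smul 0) fun x hx => by rw [h x hx, smul_zero]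
  rw [h0, hF.map_smulC 0 r hr, zero_smul]

lemma IsBidualVectorOn.sub (hF : IsBidualVectorOn A S F) (hG : IsBidualVectorOn A S G) :
    IsBidualVectorOn A S fun r => F r - G r where
  congr r s hr hs h := by rw [hF.congr r s hr hs h, hG.congr r s hr hs h]
  map_add r s hr hs := by rw [hF.map_add r s hr hs, hG.map_add r s hr hs]; abel
  map_smulC c r hr := by rw [hF.map_smulC c r hr, hG.map_smulC c r hr, smul_sub]
  map_smulA a r hr := by rw [hF.map_smulA a r hr, hG.map_smulA a r hr, sub_mul]
  bound := by
    obtain ⟨C, hC⟩ := hF.bound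
    obtain ⟨D, hD⟩ := hG.bound
    refine ⟨C + D, fun r hr => (norm_sub_le _ _).trans ?_⟩
    rw [add_mul]
    exact add_le_add (hC r hr) (hD r hr)

lemma isBidualVectorOn_omegaFun {z : M} (hz : z ∈ S) :
    IsBidualVectorOn A S (omegaFun A z) where
  congr _ _ _ _ h := h z hz
  map_add _ _ _ _ := rfl
  map_smulC _ _ _ := rfl
  map_smulA _ _ _ := rfl
  bound := ⟨‖z‖, fun _ hr => (hr.le_dualNormOn hz).trans_eq (mul_comm _ _)⟩

lemma IsBidualVectorOn.isBidualVector (hF : IsBidualVectorOn A S F) : IsBidualVector A F where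
  map_add r s hr hs := hF.map_add r s (hr.isDualVectorOn S) (hs.isDualVectorOn S)
  map_smulC c r hr := hF.map_smulC c r (hr.isDualVectorOn S)
  map_smulA a r hr := hF.map_smulA a r (hr.isDualVectorOn S)
  bound := by
    obtain ⟨C, hC0, hC⟩ := hF.exists_bound
    exact ⟨C, fun r hr => (hC r (hr.isDualVectorOn S)).trans
      (mul_le_mul_of_nonneg_left (hr.dualNormOn_le_dualNorm S) hC0)⟩

lemma bidualNormOn_omegaFun [HilbertCStarModule A M] {z : M} (hz : z ∈ S) :
    bidualNormOn A S (omegaFun A z) = ‖z‖ := by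
  have hmem : ‖z‖ ∈ {c : ℝ | 0 ≤ c ∧ ∀ r : M → A, IsDualVectorOn A S r →
      ‖omegaFun A z r‖ ≤ c * dualNormOn A S r} :=
    ⟨norm_nonneg z, fun _ hr => (hr.le_dualNormOn hz).trans_eq (mul_comm _ _)⟩
  refine le_antisymm (csInf_le ⟨0, fun _ h => h.1⟩ hmem) (le_csInf ⟨_, hmem⟩ fun c hc => ?_)
  rcases (norm_nonneg z).eq_or_lt with h0 | h0
  · rw [← h0]
    exact hc.1
  have h1 := hc.2 _ ((isDualVector_toDualFun (A := A) z).isDualVectorOn S)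
  have h2 : dualNormOn A S (toDualFun A z) ≤ ‖z‖ :=
    dualNormOn_le (norm_nonneg z) fun x _ => (norm_hInner_le x z).trans_eq (mul_comm _ _)
  have h3 := h1.trans (mul_le_mul_of_nonneg_left h2 hc.1)
  rw [omegaFun, toDualFun, norm_hInner_self, sq] at h3
  exact le_of_mul_le_mul_right h3 h0

end BidualVectors

section DoubleDual

variable {A : Type u} [NonUnitalCStarAlgebra A] {M : Type v}
  [NormedAddCommGroup M] [NormedSpace ℂ M] [SMul A M] [HilbertCStarModule A M] {T : Set M}
  {r : M → A}

attribute [local instance] CStarAlgebra.spectralOrder CStarAlgebra.spectralOrderedRing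

lemma IsDualVectorOn.norm_star_mul_self_add_le (hr : IsDualVectorOn A (orthComp A T) r)
    {x z : M} (hx : x ∈ orthComp A T) (hz : z ∈ orthComp A T) (hx1 : ‖x‖ ≤ 1) (hz1 : ‖z‖ ≤ 1) :
    ‖star (r x) * r x + star (r (z - hInner A z x • x)) * r (z - hInner A z x • x)‖
      ≤ dualNormOn A (orthComp A T) r ^ 2 := by
  set z' := z - hInner A z x • x with hz'
  have hz'S : z' ∈ orthComp A T := orthComp_sub_mem hz (orthComp_smulA_mem _ hx)
  set w := star (r x) • x + star (r z') • z' with hw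
  have hwS : w ∈ orthComp A T :=
    orthComp_add_mem (orthComp_smulA_mem _ hx) (orthComp_smulA_mem _ hz'S)
  have hrw : r w = star (r x) * r x + star (r z') * r z' := by
    rw [hw, hr.map_add _ (orthComp_smulA_mem _ hx) _ (orthComp_smulA_mem _ hz'S),
      hr.map_smulA _ x hx, hr.map_smulA _ z' hz'S]
  have h1 := norm_smul_add_smul_sub_sq_le (A := A) hx1 hz1 (star (r x)) (star (r z'))
  rw [star_star, star_star, ← hz', ← hw, ← hrw] at h1
  have h2 := hr.le_dualNormOn hwS
  rw [← hrw]
  have hD := dualNormOn_nonneg (orthComp A T) r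
  rcases (norm_nonneg (r w)).eq_or_lt with h0 | h0
  · rw [← h0]
    positivity
  · refine le_of_mul_le_mul_right ?_ h0
    calc ‖r w‖ * ‖r w‖ = ‖r w‖ ^ 2 := (sq _).symm
      _ ≤ (dualNormOn A (orthComp A T) r * ‖w‖) ^ 2 := pow_le_pow_left₀ h0.le h2 2
      _ = dualNormOn A (orthComp A T) r ^ 2 * ‖w‖ ^ 2 := mul_pow _ _ _
      _ ≤ _ := mul_le_mul_of_nonneg_left h1 (sq_nonneg _)

/-- If `d` localizes near the top of the spectrum of `star (r x) * r x`, then `r d` is close to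
`⟨·, star (r x) • x⟩ d`. -/
lemma IsDualVectorOn.dualNormOn_sub_mul_le (hr : IsDualVectorOn A (orthComp A T) r)
    {x : M} (hx : x ∈ orthComp A T) (hx1 : ‖x‖ ≤ 1) {d : A} (hd : IsSelfAdjoint d) {ε : ℝ}
    (hdε : ‖(dualNormOn A (orthComp A T) r ^ 2) • (d * d) - d * (star (r x) * r x) * d‖
      ≤ ε ^ 2 * ‖d‖ ^ 2) (hε : 0 ≤ ε) :
    dualNormOn A (orthComp A T) (fun z => (r z - toDualFun A (star (r x) • x) z) * d)
      ≤ ε * ‖d‖ := by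
  have hs : IsDualVectorOn A (orthComp A T)
      (fun z => (r z - toDualFun A (star (r x) • x) z) * d) :=
    (hr.sub ((isDualVector_toDualFun _).isDualVectorOn _)).mul_right d
  have hunit : ∀ z ∈ orthComp A T, ‖z‖ ≤ 1 →
      ‖(r z - toDualFun A (star (r x) • x) z) * d‖ ≤ ε * ‖d‖ := by
    intro z hz hz1
    have hpS : hInner A z x • x ∈ orthComp A T := orthComp_smulA_mem _ hx
    have heq : r z - toDualFun A (star (r x) • x) z = r (z - hInner A z x • x) := by
      rw [hr.map_sub hz hpS (orthComp_smulC_mem _ hpS), hr.map_smulA _ x hx, toDualFun,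
        hInner_smulA_right, star_star]
    rw [heq]
    set q := r (z - hInner A z x • x) with hq
    have h1 := hr.norm_star_mul_self_add_le hx hz hx1 hz1
    rw [← hq] at h1
    have h2 := CStarAlgebra.star_left_conjugate_le_norm_smul (a := d)
      (b := star (r x) * r x + star q * q)
      ((IsSelfAdjoint.star_mul_self _).add (IsSelfAdjoint.star_mul_self _))
    rw [hd.star_eq] at h2
    have h3 := h2.trans (smul_le_smul_of_nonneg_right h1
      (by simpa [hd.star_eq] using star_mul_self_nonneg d))
    have h4 : star (q * d) * (q * d)
        ≤ (dualNormOn A (orthComp A T) r ^ 2) • (d * d) - d * (star (r x) * r x) * d := by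
      rw [le_sub_iff_add_le]
      refine (le_of_eq ?_).trans h3
      rw [star_mul, hd.star_eq]
      noncomm_ring
    have h5 := (CStarAlgebra.norm_le_norm_of_nonneg_of_le (star_mul_self_nonneg _) h4).trans hdε
    rw [CStarRing.norm_star_mul_self, ← sq, ← mul_pow] at h5
    exact abs_le_of_sq_le_sq' h5 (by positivity) |>.2
  refine dualNormOn_le (by positivity) fun z hz => ?_
  rcases (norm_nonneg z).eq_or_lt with h0 | h0
  · simpa [← h0] using hs.le_dualNormOn hz
  · have h1 := hunit (((‖z‖⁻¹ : ℝ) : ℂ) • z) (orthComp_smulC_mem _ hz) (by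
      rw [norm_smul, Complex.norm_real, norm_inv, norm_norm, inv_mul_cancel₀ h0.ne'])
    have h2 := hs.map_smulC ((‖z‖⁻¹ : ℝ) : ℂ) z hz
    rw [h2, norm_smul, Complex.norm_real, norm_inv, norm_norm, inv_mul_le_iff₀ h0] at h1
    rwa [mul_comm ‖z‖] at h1

lemma IsDualVectorOn.exists_unit_lt (hr : IsDualVectorOn A (orthComp A T) r) {c : ℝ}
    (hc0 : 0 ≤ c) (hc : c < dualNormOn A (orthComp A T) r) :
    ∃ x ∈ orthComp A T, ‖x‖ ≤ 1 ∧ c < ‖r x‖ := by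
  by_contra! h
  refine hc.not_ge (dualNormOn_le hc0 fun z hz => ?_)
  rcases (norm_nonneg z).eq_or_lt with h0 | h0
  · simpa [← h0] using hr.le_dualNormOn hz
  · have h1 := h (((‖z‖⁻¹ : ℝ) : ℂ) • z) (orthComp_smulC_mem _ hz) (by
      rw [norm_smul, Complex.norm_real, norm_inv, norm_norm, inv_mul_cancel₀ h0.ne'])
    rw [hr.map_smulC _ z hz, norm_smul, Complex.norm_real, norm_inv, norm_norm,
      inv_mul_le_iff₀ h0] at h1
    rwa [mul_comm ‖z‖] at h1

/-- Paschke: the canonical map from the `A`-bidual to the `A`-dual is injective. -/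
lemma IsBidualVectorOn.eq_zero_of_map_toDualFun {G : (M → A) → A}
    (hG : IsBidualVectorOn A (orthComp A T) G)
    (h0 : ∀ y ∈ orthComp A T, G (toDualFun A y) = 0)
    (hr : IsDualVectorOn A (orthComp A T) r) : G r = 0 := by
  by_contra hb
  obtain ⟨C, hC0, hC⟩ := hG.exists_bound
  set b := G r with hbdef
  set s : M → A := fun x => r x * star b with hsdef
  have hs : IsDualVectorOn A (orthComp A T) s := hr.mul_right _
  have hGs : G s = b * star b := hG.map_mul_right hr _
  set R := dualNormOn A (orthComp A T) r with hR
  set m := dualNormOn A (orthComp A T) s ^ 2 with hm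
  have hD0 := dualNormOn_nonneg (orthComp A T) s
  have hR0 : 0 ≤ R := dualNormOn_nonneg (orthComp A T) r
  have hDpos : 0 < dualNormOn A (orthComp A T) s := by
    refine hD0.lt_of_ne fun h => hb ?_
    have h1 := hC s hs
    rw [← h, mul_zero, hGs, CStarRing.norm_self_mul_star] at h1
    exact norm_eq_zero.1 (mul_self_eq_zero.1 (le_antisymm h1 (by positivity)))
  have hmpos : 0 < m := by positivity
  have key : ∀ η : ℝ, 0 < η → η ^ 2 ≤ m → m ≤ η ^ 2 + R ^ 2 * C * η := by
    intro η hη hηm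
    obtain ⟨x, hx, hx1, hlt⟩ := hs.exists_unit_lt (Real.sqrt_nonneg (m - η ^ 2))
      ((Real.sqrt_lt' hDpos).2 (by rw [← hm]; nlinarith))
    set k := star (s x) * s x with hk
    have hkn : ‖k‖ = ‖s x‖ ^ 2 := by rw [hk, CStarRing.norm_star_mul_self, sq]
    have hmk : m - η ^ 2 < ‖k‖ := by
      rw [hkn]
      exact (Real.sqrt_lt_sqrt_iff (by linarith)).1
        (by rwa [Real.sqrt_sq (norm_nonneg _)])
    have hkm : ‖k‖ ≤ m := by
      rw [hkn]
      refine pow_le_pow_left₀ (norm_nonneg _) ((hs.le_dualNormOn hx).trans ?_) 2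
      exact mul_le_of_le_one_right hD0 hx1
    obtain ⟨d, hd, hd0, hdε⟩ :=
      exists_isSelfAdjoint_norm_smul_sub_conj_le (star_mul_self_nonneg (s x)) hηm hkm hmk
    have hdn : 0 < ‖d‖ := norm_pos_iff.2 hd0
    have hGd : ‖G s * d‖ ≤ C * (η * ‖d‖) := by
      have hy := (isDualVector_toDualFun (A := A) (star (s x) • x)).isDualVectorOn (orthComp A T)
      have h1 := hC _ ((hs.sub hy).mul_right d)
      rw [hG.map_mul_right (hs.sub hy), hG.map_sub hs hy, h0 _ (orthComp_smulA_mem _ hx),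
        sub_zero] at h1
      exact h1.trans (mul_le_mul_of_nonneg_left (hs.dualNormOn_sub_mul_le hx hx1 hd hdε hη.le) hC0)
    have hlow : (m - η ^ 2) * ‖d‖ ^ 2 ≤ ‖d * k * d‖ := by
      have h1 := norm_sub_norm_le (m • (d * d)) (d * k * d)
      have h2 : ‖m • (d * d)‖ = m * ‖d‖ ^ 2 := by
        rw [norm_smul, Real.norm_of_nonneg hmpos.le, sq]
        nth_rewrite 1 [← hd.star_eq]
        rw [CStarRing.norm_star_mul_self]
      rw [h2] at h1
      linarith [h1.trans hdε]
    have hup : ‖d * k * d‖ ≤ R ^ 2 * (‖d‖ * ‖G s * d‖) := by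
      have h1 : ‖star (r x) * r x‖ ≤ R ^ 2 := by
        rw [CStarRing.norm_star_mul_self, ← sq]
        refine pow_le_pow_left₀ (norm_nonneg _) ((hr.le_dualNormOn hx).trans ?_) 2
        exact mul_le_of_le_one_right hR0 hx1
      have h2 := (CStarAlgebra.star_right_conjugate_le_norm_smul (a := d * b)
        (IsSelfAdjoint.star_mul_self (r x))).trans
          (smul_le_smul_of_nonneg_right h1 (mul_star_self_nonneg (d * b)))
      have h3 : d * b * (star (r x) * r x) * star (d * b) = d * k * d := by
        simp only [hk, hsdef, star_mul, star_star, hd.star_eq, mul_assoc]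
      have h4 : d * b * star (d * b) = d * (G s * d) := by
        simp only [hGs, star_mul, hd.star_eq, mul_assoc]
      rw [h3, h4] at h2
      have h5 : 0 ≤ d * k * d := by
        have := star_left_conjugate_nonneg (star_mul_self_nonneg (s x)) d
        rwa [hd.star_eq] at this
      refine (CStarAlgebra.norm_le_norm_of_nonneg_of_le h5 h2).trans ?_
      rw [norm_smul, Real.norm_of_nonneg (sq_nonneg R)]
      exact mul_le_mul_of_nonneg_left (norm_mul_le _ _) (sq_nonneg R)
    have hfin : (m - η ^ 2) * ‖d‖ ^ 2 ≤ (R ^ 2 * C * η) * ‖d‖ ^ 2 := by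
      calc _ ≤ R ^ 2 * (‖d‖ * ‖G s * d‖) := hlow.trans hup
        _ ≤ R ^ 2 * (‖d‖ * (C * (η * ‖d‖))) := by gcongr
        _ = _ := by ring
    linarith [le_of_mul_le_mul_right hfin (by positivity)]
  have hK : 0 ≤ R ^ 2 * C := by positivity
  have hden : 0 < m + 1 + R ^ 2 * C := by positivity
  set η := m / (m + 1 + R ^ 2 * C) with hη
  have hη0 : 0 < η := by positivity
  have hηmul : η * (m + 1 + R ^ 2 * C) = m := div_mul_cancel₀ _ hden.ne'
  have hη1 : η < 1 := (div_lt_one hden).2 (by linarith)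
  have hηsq : η ^ 2 ≤ η := by nlinarith
  have hηm : η ≤ m := by nlinarith
  have := key η hη0 (hηsq.trans hηm)
  nlinarith [mul_pos hη0 hmpos]

end DoubleDual

/-- STATEMENT 12: If `M` is an `A`-reflexive Hilbert `A`-module and `N ⊆ M` a Hilbert
`A`-submodule, then the biorthogonal complement `N^⊥⊥` (computed in `M`) is `A`-reflexive:
the canonical map `Ω : N^⊥⊥ → (N^⊥⊥)''` is an isometric isomorphism. -/
theorem biorthogonal_complement_reflexive
    (A : Type u) [NonUnitalCStarAlgebra A]
    (M : Type v) [NormedAddCommGroup M] [NormedSpace ℂ M] [SMul A M] [HilbertCStarModule A M]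
    (hrefl : IsCReflexive A (M := M))
    (N : Set M) (hN : IsHilbertSubmodule A N) :
    (∀ F : (M → A) → A, IsBidualVectorOn A (orthComp A (orthComp A N)) F →
      ∃ z ∈ orthComp A (orthComp A N),
        ∀ r : M → A, IsDualVectorOn A (orthComp A (orthComp A N)) r → F r = r z) ∧
    (∀ z ∈ orthComp A (orthComp A N),
      bidualNormOn A (orthComp A (orthComp A N)) (omegaFun A z) = ‖z‖) := by
  refine ⟨fun F hF => ?_, fun z hz => bidualNormOn_omegaFun hz⟩
  obtain ⟨z, hz⟩ := hrefl F hF.isBidualVector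
  have hzS : z ∈ orthComp A (orthComp A N) := fun y hy => by
    have hdual := isDualVector_toDualFun (A := A) y
    have h := hF.map_eq_zero (hdual.isDualVectorOn _) fun x hx => hx y hy
    rwa [hz _ hdual] at h
  refine ⟨z, hzS, fun r hr => sub_eq_zero.1 ?_⟩
  exact (hF.sub (isBidualVectorOn_omegaFun hzS)).eq_zero_of_map_toDualFun
    (fun y _ => sub_eq_zero.2 (hz _ (isDualVector_toDualFun y))) hr
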